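/- For any two roots δ₁, δ₂ ∈ R with B(δ₁,δ₂) = 1 (so that δ₁, δ₂ span a sub-root system of type A₂), the number of orbits of the subgroup generated by the two reflections r_{δ₁}, r_{δ₂} acting on the 72-element set R is exactly 31. (The A₂ row of Table 1: a cubic surface hyperplane section with one A₂ singularity has exactly 31 limiting primitive vanishing cycles.) -/

import Mathlib

/-- The intersection form on the lattice `I^{1,6} ≅ H²(S,ℤ)` of a smooth cubic surface. -/
def B (x y : Fin 7 → ℤ) : ℤ := x 0 * y 0 - ∑ i : Fin 6, x i.succ * y i.succ

/-- The hyperplane class `h = 3e₀ - e₁ - ⋯ - e₆`. -/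
def h : Fin 7 → ℤ := fun j => if j = 0 then 3 else -1

/-- The root system `R = {α : B(α,α) = -2, B(α,h) = 0}` (primitive vanishing cycles). -/
def R : Set (Fin 7 → ℤ) := {α | B α α = -2 ∧ B α h = 0}

/-- The reflection `r_α(β) = β + B(β,α)·α` in a root `α`. -/
def reflect (α β : Fin 7 → ℤ) : Fin 7 → ℤ := β + B β α • α

/-- Computable version of the form, on coordinate lists. -/
def dotTail : List ℤ → List ℤ → ℤ
  | a :: l, b :: m => a * b + dotTail l m
  | _, _ => 0

def dotL : List ℤ → List ℤ → ℤ
  | a :: l, b :: m => a * b - dotTail l m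
  | _, _ => 0

/-- The 72 roots as coordinate lists. -/
def rootL : List (List ℤ) := [
  [-2,1,1,1,1,1,1], [-1,0,0,0,1,1,1], [-1,0,0,1,0,1,1], [-1,0,0,1,1,0,1],
  [-1,0,0,1,1,1,0], [-1,0,1,0,0,1,1], [-1,0,1,0,1,0,1], [-1,0,1,0,1,1,0],
  [-1,0,1,1,0,0,1], [-1,0,1,1,0,1,0], [-1,0,1,1,1,0,0], [-1,1,0,0,0,1,1],
  [-1,1,0,0,1,0,1], [-1,1,0,0,1,1,0], [-1,1,0,1,0,0,1], [-1,1,0,1,0,1,0],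
  [-1,1,0,1,1,0,0], [-1,1,1,0,0,0,1], [-1,1,1,0,0,1,0], [-1,1,1,0,1,0,0],
  [-1,1,1,1,0,0,0], [0,-1,0,0,0,0,1], [0,-1,0,0,0,1,0], [0,-1,0,0,1,0,0],
  [0,-1,0,1,0,0,0], [0,-1,1,0,0,0,0], [0,0,-1,0,0,0,1], [0,0,-1,0,0,1,0],
  [0,0,-1,0,1,0,0], [0,0,-1,1,0,0,0], [0,0,0,-1,0,0,1], [0,0,0,-1,0,1,0],
  [0,0,0,-1,1,0,0], [0,0,0,0,-1,0,1], [0,0,0,0,-1,1,0], [0,0,0,0,0,-1,1],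
  [0,0,0,0,0,1,-1], [0,0,0,0,1,-1,0], [0,0,0,0,1,0,-1], [0,0,0,1,-1,0,0],
  [0,0,0,1,0,-1,0], [0,0,0,1,0,0,-1], [0,0,1,-1,0,0,0], [0,0,1,0,-1,0,0],
  [0,0,1,0,0,-1,0], [0,0,1,0,0,0,-1], [0,1,-1,0,0,0,0], [0,1,0,-1,0,0,0],
  [0,1,0,0,-1,0,0], [0,1,0,0,0,-1,0], [0,1,0,0,0,0,-1], [1,-1,-1,-1,0,0,0],
  [1,-1,-1,0,-1,0,0], [1,-1,-1,0,0,-1,0], [1,-1,-1,0,0,0,-1], [1,-1,0,-1,-1,0,0],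
  [1,-1,0,-1,0,-1,0], [1,-1,0,-1,0,0,-1], [1,-1,0,0,-1,-1,0], [1,-1,0,0,-1,0,-1],
  [1,-1,0,0,0,-1,-1], [1,0,-1,-1,-1,0,0], [1,0,-1,-1,0,-1,0], [1,0,-1,-1,0,0,-1],
  [1,0,-1,0,-1,-1,0], [1,0,-1,0,-1,0,-1], [1,0,-1,0,0,-1,-1], [1,0,0,-1,-1,-1,0],
  [1,0,0,-1,-1,0,-1], [1,0,0,-1,0,-1,-1], [1,0,0,0,-1,-1,-1], [2,-1,-1,-1,-1,-1,-1]]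

def toF (l : List ℤ) : Fin 7 → ℤ := fun i => l.getD i 0

def ofF (x : Fin 7 → ℤ) : List ℤ := [x 0, x 1, x 2, x 3, x 4, x 5, x 6]

theorem toF_ofF (x : Fin 7 → ℤ) : toF (ofF x) = x := by
  funext i
  fin_cases i <;> rfl

theorem B_ofF (x y : Fin 7 → ℤ) : B x y = dotL (ofF x) (ofF y) := by
  simp only [B, ofF, dotL, dotTail, Fin.sum_univ_six]
  simp only [Fin.succ, Fin.isValue]
  rw [add_zero]
  simp only [add_assoc]
  rfl

theorem rootL_spec : ∀ l ∈ rootL, ofF (toF l) = l ∧ dotL l l = -2 ∧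
    dotL l [3, -1, -1, -1, -1, -1, -1] = 0 := by
  decide +kernel

theorem rootL_nodup : rootL.Nodup := by decide +kernel

theorem rootL_complete : ∀ a ∈ [(-2 : ℤ), -1, 0, 1, 2], ∀ b ∈ [(-1 : ℤ), 0, 1],
    ∀ c ∈ [(-1 : ℤ), 0, 1], ∀ d ∈ [(-1 : ℤ), 0, 1], ∀ e ∈ [(-1 : ℤ), 0, 1],
    ∀ f ∈ [(-1 : ℤ), 0, 1], ∀ g ∈ [(-1 : ℤ), 0, 1],
    3 * a + b + c + d + e + f + g = 0 →
    a * a - (b * b + c * c + d * d + e * e + f * f + g * g) = -2 →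
    [a, b, c, d, e, f, g] ∈ rootL := by
  decide +kernel

/-- The number of dominant roots is 31, for each pair. -/
theorem rootL_count : ∀ d ∈ rootL, ∀ e ∈ rootL, dotL d e = 1 →
    ((rootL.filter (fun b => decide (0 ≤ dotL b d))).filter
      (fun b => decide (0 ≤ dotL b e))).length = 31 := by
  decide +kernel

theorem ofF_h : ofF h = [3, -1, -1, -1, -1, -1, -1] := by decide

theorem small_of_sq (u : ℤ) (hu : u * u ≤ 3) : -1 ≤ u ∧ u ≤ 1 := by
  constructor <;> nlinarith

/-- Each coordinate of a root after the first has absolute value at most one. -/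
theorem coord_bound (a : ℤ) (ha1 : -2 ≤ a) (ha2 : a ≤ 2) (u v w y z t : ℤ)
    (k1 : 3 * a + u + v + w + y + z + t = 0)
    (k2 : a * a - (u * u + v * v + w * w + y * y + z * z + t * t) = -2) :
    u ∈ [(-1 : ℤ), 0, 1] := by
  have main : -1 ≤ u ∧ u ≤ 1 := by
    have p1 := mul_self_nonneg v
    have p2 := mul_self_nonneg w
    have p3 := mul_self_nonneg y
    have p4 := mul_self_nonneg z
    have p5 := mul_self_nonneg t
    by_cases c2 : a = 2
    · subst c2
      have q : (u + 1) * (u + 1) ≤ 0 := by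
        linarith [mul_self_nonneg (v + 1), mul_self_nonneg (w + 1), mul_self_nonneg (y + 1),
          mul_self_nonneg (z + 1), mul_self_nonneg (t + 1)]
      have : u + 1 = 0 := mul_self_eq_zero.1 (le_antisymm q (mul_self_nonneg _))
      omega
    by_cases c3 : a = -2
    · subst c3
      have q : (u - 1) * (u - 1) ≤ 0 := by
        linarith [mul_self_nonneg (v - 1), mul_self_nonneg (w - 1), mul_self_nonneg (y - 1),
          mul_self_nonneg (z - 1), mul_self_nonneg (t - 1)]
      have : u - 1 = 0 := mul_self_eq_zero.1 (le_antisymm q (mul_self_nonneg _))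
      omega
    have b1 : -1 ≤ a := by omega
    have b2 : a ≤ 1 := by omega
    have b3 : a * a ≤ 1 := by
      clear k1 k2 p1 p2 p3 p4 p5
      nlinarith
    exact small_of_sq u (by linarith)
  obtain ⟨l1, l2⟩ := main
  clear k1 k2
  interval_cases u <;> simp

theorem mem_R_iff (x : Fin 7 → ℤ) : x ∈ R ↔ ofF x ∈ rootL := by
  constructor
  · rintro ⟨h1, h2⟩
    rw [B_ofF] at h1 h2
    rw [ofF_h] at h2
    simp only [ofF, dotL, dotTail] at h1 h2 ⊢
    generalize x 0 = a at *
    generalize x 1 = b at *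
    generalize x 2 = c at *
    generalize x 3 = d at *
    generalize x 4 = e at *
    generalize x 5 = f at *
    generalize x 6 = g at *
    have hs : 3 * a + b + c + d + e + f + g = 0 := by linarith
    have hq : a * a - (b * b + c * c + d * d + e * e + f * f + g * g) = -2 := by linarith
    have ha : a * a ≤ 4 := by
      have hs2 : b + c + d + e + f + g = -3 * a := by linarith
      have : (b + c + d + e + f + g) ^ 2 ≤ 6 * (b * b + c * c + d * d + e * e + f * f + g * g) := by
        clear h1 h2 hs hq hs2
        linarith [sq_nonneg (b - c), sq_nonneg (b - d), sq_nonneg (b - e), sq_nonneg (b - f),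
          sq_nonneg (b - g), sq_nonneg (c - d), sq_nonneg (c - e), sq_nonneg (c - f),
          sq_nonneg (c - g), sq_nonneg (d - e), sq_nonneg (d - f), sq_nonneg (d - g),
          sq_nonneg (e - f), sq_nonneg (e - g), sq_nonneg (f - g)]
      rw [hs2] at this
      linarith
    have ha1 : -2 ≤ a := by
      clear h1 h2 hs hq
      nlinarith
    have ha2 : a ≤ 2 := by
      clear h1 h2 hs hq
      nlinarith
    -- each coordinate has absolute value at most one
    have key := coord_bound a ha1 ha2
    have hab : a ∈ [(-2 : ℤ), -1, 0, 1, 2] := by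
      clear h1 h2 hs hq key ha
      interval_cases a <;> simp
    exact rootL_complete a hab
      b (key b c d e f g (by linarith) (by linarith))
      c (key c b d e f g (by linarith) (by linarith))
      d (key d c b e f g (by linarith) (by linarith))
      e (key e c d b f g (by linarith) (by linarith))
      f (key f c d e b g (by linarith) (by linarith))
      g (key g c d e f b (by linarith) (by linarith)) hs hq
  · intro hx
    obtain ⟨-, h1, h2⟩ := rootL_spec _ hx
    exact ⟨by rw [B_ofF, h1], by rw [B_ofF, ofF_h, h2]⟩

theorem B_add_smul_left (x y z : Fin 7 → ℤ) (c : ℤ) : B (x + c • y) z = B x z + c * B y z := by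
  simp only [B, Pi.add_apply, Pi.smul_apply, smul_eq_mul, Fin.sum_univ_six]
  ring

theorem B_symm (x y : Fin 7 → ℤ) : B x y = B y x := by
  simp only [B, mul_comm]

theorem B_reflect_left (a x z : Fin 7 → ℤ) : B (reflect a x) z = B x z + B x a * B a z :=
  B_add_smul_left _ _ _ _

theorem reflect_mem_R {a x : Fin 7 → ℤ} (ha : a ∈ R) (hx : x ∈ R) : reflect a x ∈ R := by
  obtain ⟨a1, a2⟩ := ha
  obtain ⟨x1, x2⟩ := hx
  constructor
  · rw [B_reflect_left, B_symm x, B_symm a, B_reflect_left, B_reflect_left, x1, a1, B_symm a x]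
    ring
  · rw [B_reflect_left, a2, x2]
    ring

/-- The dominant roots. -/
theorem dominant_ncard (d e : Fin 7 → ℤ) (hd : d ∈ R) (he : e ∈ R) (hp : B d e = 1) :
    {b | b ∈ R ∧ 0 ≤ B b d ∧ 0 ≤ B b e}.ncard = 31 := by
  have hc := rootL_count _ ((mem_R_iff d).1 hd) _ ((mem_R_iff e).1 he) (by rw [← B_ofF, hp])
  set M := ((rootL.filter (fun b => decide (0 ≤ dotL b (ofF d)))).filter
      (fun b => decide (0 ≤ dotL b (ofF e)))) with hM
  have hnd : M.Nodup := (rootL_nodup.filter _).filter _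
  have hcard : M.toFinset.card = 31 := by rw [List.toFinset_card_of_nodup hnd, hc]
  have hmem : ∀ l, l ∈ M ↔ l ∈ rootL ∧ 0 ≤ dotL l (ofF d) ∧ 0 ≤ dotL l (ofF e) := by
    intro l
    simp only [hM, List.mem_filter, decide_eq_true_eq, and_assoc]
  have himg : {b | b ∈ R ∧ 0 ≤ B b d ∧ 0 ≤ B b e} = toF '' (M.toFinset : Set (List ℤ)) := by
    ext b
    simp only [Set.mem_ofPred_eq, Set.mem_image, List.coe_toFinset, hmem]
    constructor
    · rintro ⟨h1, h2, h3⟩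
      rw [B_ofF] at h2 h3
      exact ⟨ofF b, ⟨(mem_R_iff b).1 h1, h2, h3⟩, toF_ofF b⟩
    · rintro ⟨l, ⟨h1, h2, h3⟩, rfl⟩
      have hl := (rootL_spec l h1).1
      rw [mem_R_iff, B_ofF, B_ofF, hl]
      exact ⟨h1, h2, h3⟩
  rw [himg, Set.ncard_image_of_injOn, Set.ncard_coe_finset, hcard]
  intro l hl m hm hlm
  have h1 : l ∈ rootL := ((hmem l).1 (by simpa using hl)).1
  have h2 : m ∈ rootL := ((hmem m).1 (by simpa using hm)).1
  rw [← (rootL_spec l h1).1, ← (rootL_spec m h2).1, hlm]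

/-- A group generated by two involutions satisfying the braid relation has at most six elements. -/
theorem closure_cases {G : Type*} [Group G] (s t : G) (hs : s * s = 1) (ht : t * t = 1)
    (hb : s * (t * s) = t * (s * t)) (g : G) (hg : g ∈ Subgroup.closure {s, t}) :
    g = 1 ∨ g = s ∨ g = t ∨ g = s * t ∨ g = t * s ∨ g = s * (t * s) := by
  have hs' : ∀ x, s * (s * x) = x := fun x => by rw [← mul_assoc, hs, one_mul]
  have ht' : ∀ x, t * (t * x) = x := fun x => by rw [← mul_assoc, ht, one_mul]
  have si : s⁻¹ = s := inv_eq_of_mul_eq_one_left hs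
  have ti : t⁻¹ = t := inv_eq_of_mul_eq_one_left ht
  have stepS : ∀ y : G, (y = 1 ∨ y = s ∨ y = t ∨ y = s * t ∨ y = t * s ∨ y = s * (t * s)) →
      (s * y = 1 ∨ s * y = s ∨ s * y = t ∨ s * y = s * t ∨ s * y = t * s ∨
        s * y = s * (t * s)) := by
    rintro y (rfl | rfl | rfl | rfl | rfl | rfl)
    · simp
    · simp [hs]
    · simp
    · simp [hs']
    · simp
    · simp [hs']
  have stepT : ∀ y : G, (y = 1 ∨ y = s ∨ y = t ∨ y = s * t ∨ y = t * s ∨ y = s * (t * s)) →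
      (t * y = 1 ∨ t * y = s ∨ t * y = t ∨ t * y = s * t ∨ t * y = t * s ∨
        t * y = s * (t * s)) := by
    rintro y (rfl | rfl | rfl | rfl | rfl | rfl)
    · simp
    · simp
    · simp [ht]
    · simp [hb]
    · simp [ht']
    · rw [hb, ht']
      simp
  induction hg using Subgroup.closure_induction_left with
  | one => simp
  | mul_left x hx y _ ih =>
    rcases hx with rfl | hx
    · exact stepS y ih
    · rw [Set.mem_singleton_iff] at hx
      subst hx
      exact stepT y ih
  | inv_mul_cancel x hx y _ ih =>
    rcases hx with rfl | hx
    · rw [si]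
      exact stepS y ih
    · rw [Set.mem_singleton_iff] at hx
      subst hx
      rw [ti]
      exact stepT y ih

/-- For two roots with `B(δ₁,δ₂) = 1` (spanning a sub-root system of type `A₂`), the subgroup
generated by the two reflections `r_{δ₁}, r_{δ₂}` has exactly 31 orbits on the 72 roots. -/
theorem orbits_A2 (δ₁ δ₂ : Fin 7 → ℤ) (h₁ : δ₁ ∈ R) (h₂ : δ₂ ∈ R)
    (hpair : B δ₁ δ₂ = 1)
    (g₁ g₂ : Equiv.Perm (Fin 7 → ℤ))
    (hg₁ : ∀ β, g₁ β = reflect δ₁ β) (hg₂ : ∀ β, g₂ β = reflect δ₂ β) :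
    {O : Set (Fin 7 → ℤ) | ∃ β ∈ R,
      O = MulAction.orbit (Subgroup.closure {g₁, g₂} : Subgroup (Equiv.Perm (Fin 7 → ℤ))) β}.ncard
      = 31 := by
  have n₁ : B δ₁ δ₁ = -2 := h₁.1
  have n₂ : B δ₂ δ₂ = -2 := h₂.1
  have hpair' : B δ₂ δ₁ = 1 := by rw [B_symm, hpair]
  have a11 : ∀ x, B (g₁ x) δ₁ = - B x δ₁ := fun x => by
    rw [hg₁, B_reflect_left, n₁]; ring
  have a12 : ∀ x, B (g₁ x) δ₂ = B x δ₁ + B x δ₂ := fun x => by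
    rw [hg₁, B_reflect_left, hpair]; ring
  have a21 : ∀ x, B (g₂ x) δ₁ = B x δ₁ + B x δ₂ := fun x => by
    rw [hg₂, B_reflect_left, hpair']; ring
  have a22 : ∀ x, B (g₂ x) δ₂ = - B x δ₂ := fun x => by
    rw [hg₂, B_reflect_left, n₂]; ring
  have e₁ : ∀ x, g₁ x = x + B x δ₁ • δ₁ := hg₁
  have e₂ : ∀ x, g₂ x = x + B x δ₂ • δ₂ := hg₂
  have R₁ : ∀ x ∈ R, g₁ x ∈ R := fun x hx => by rw [hg₁]; exact reflect_mem_R h₁ hx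
  have R₂ : ∀ x ∈ R, g₂ x ∈ R := fun x hx => by rw [hg₂]; exact reflect_mem_R h₂ hx
  have hs : g₁ * g₁ = 1 := by
    ext1 x
    rw [Equiv.Perm.mul_apply, Equiv.Perm.one_apply, e₁ (g₁ x), a11, e₁ x]
    module
  have ht : g₂ * g₂ = 1 := by
    ext1 x
    rw [Equiv.Perm.mul_apply, Equiv.Perm.one_apply, e₂ (g₂ x), a22, e₂ x]
    module
  have hb : g₁ * (g₂ * g₁) = g₂ * (g₁ * g₂) := by
    ext1 x
    simp only [Equiv.Perm.mul_apply]
    rw [e₁ (g₂ (g₁ x)), a21, e₂ (g₁ x), a11, a12, e₁ x,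
      e₂ (g₁ (g₂ x)), a12, e₁ (g₂ x), a21, a22, e₂ x]
    module
  set H : Subgroup (Equiv.Perm (Fin 7 → ℤ)) := Subgroup.closure {g₁, g₂} with hH
  have m₁ : g₁ ∈ H := Subgroup.subset_closure (by simp)
  have m₂ : g₂ ∈ H := Subgroup.subset_closure (by simp)
  -- existence of a dominant element in each orbit
  have hex : ∀ x ∈ R, ∃ g ∈ H, g x ∈ R ∧ 0 ≤ B (g x) δ₁ ∧ 0 ≤ B (g x) δ₂ := by
    intro x hx
    by_cases c1 : 0 ≤ B x δ₁ <;> by_cases c2 : 0 ≤ B x δ₂ <;>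
      by_cases c3 : 0 ≤ B x δ₁ + B x δ₂
    · exact ⟨1, H.one_mem, hx, c1, c2⟩
    · omega
    · exact ⟨g₂, m₂, R₂ x hx, by rw [a21]; omega, by rw [a22]; omega⟩
    · refine ⟨g₁ * g₂, H.mul_mem m₁ m₂, R₁ _ (R₂ x hx), ?_, ?_⟩
      · rw [Equiv.Perm.mul_apply, a11, a21]; omega
      · rw [Equiv.Perm.mul_apply, a12, a21, a22]; omega
    · exact ⟨g₁, m₁, R₁ x hx, by rw [a11]; omega, by rw [a12]; omega⟩
    · refine ⟨g₂ * g₁, H.mul_mem m₂ m₁, R₂ _ (R₁ x hx), ?_, ?_⟩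
      · rw [Equiv.Perm.mul_apply, a21, a11, a12]; omega
      · rw [Equiv.Perm.mul_apply, a22, a12]; omega
    · omega
    · refine ⟨g₁ * (g₂ * g₁), H.mul_mem m₁ (H.mul_mem m₂ m₁), R₁ _ (R₂ _ (R₁ x hx)), ?_, ?_⟩
      · rw [Equiv.Perm.mul_apply, Equiv.Perm.mul_apply, a11, a21, a11, a12]; omega
      · rw [Equiv.Perm.mul_apply, Equiv.Perm.mul_apply, a12, a21, a22, a11, a12]; omega
  -- uniqueness of the dominant element
  have huniq : ∀ x, 0 ≤ B x δ₁ → 0 ≤ B x δ₂ → ∀ g ∈ H, 0 ≤ B (g x) δ₁ → 0 ≤ B (g x) δ₂ →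
      g x = x := by
    intro x x1 x2 g hg
    have f₁ : B x δ₁ = 0 → g₁ x = x := fun hz => by rw [e₁, hz, zero_smul, add_zero]
    have f₂ : B x δ₂ = 0 → g₂ x = x := fun hz => by rw [e₂, hz, zero_smul, add_zero]
    rcases closure_cases g₁ g₂ hs ht hb g hg with rfl | rfl | rfl | rfl | rfl | rfl
    · intros; rfl
    · rw [a11]
      intro y1 _
      exact f₁ (by omega)
    · rw [a22]
      intro _ y1
      exact f₂ (by omega)
    · rw [Equiv.Perm.mul_apply, a11, a21]
      intro y1 _
      rw [f₂ (by omega), f₁ (by omega)]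
    · rw [Equiv.Perm.mul_apply, a22, a12]
      intro _ y1
      rw [f₁ (by omega), f₂ (by omega)]
    · rw [Equiv.Perm.mul_apply, Equiv.Perm.mul_apply, a11, a21, a11, a12, a12, a21, a22, a11, a12]
      intro y1 y2
      rw [f₁ (by omega), f₂ (by omega), f₁ (by omega)]
  have himg : {O : Set (Fin 7 → ℤ) | ∃ β ∈ R, O = MulAction.orbit H β} =
      (fun β => MulAction.orbit H β) '' {b | b ∈ R ∧ 0 ≤ B b δ₁ ∧ 0 ≤ B b δ₂} := by
    ext O
    constructor
    · rintro ⟨x, hx, rfl⟩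
      obtain ⟨g, hg, hd⟩ := hex x hx
      exact ⟨g x, hd, MulAction.orbit_eq_iff.2 ⟨⟨g, hg⟩, rfl⟩⟩
    · rintro ⟨x, ⟨hx, -⟩, rfl⟩
      exact ⟨x, hx, rfl⟩
  rw [himg, Set.ncard_image_of_injOn, dominant_ncard δ₁ δ₂ h₁ h₂ hpair]
  rintro x ⟨-, x1, x2⟩ y ⟨-, y1, y2⟩ hxy
  obtain ⟨⟨g, hg⟩, hgx⟩ := MulAction.orbit_eq_iff.1 hxy
  have hgx' : g y = x := hgx
  rw [← hgx'] at x1 x2 ⊢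
  exact huniq y y1 y2 g hg x1 x2
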